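/- arXiv:2310.14182 — 2 statements merged into one kernel-verified Lean document; each statement's English description precedes it below -/
import Mathlib

section
/- Let E be a real inner product space, A ⊆ E an atomic set symmetric with respect to the origin, y ∈ E and ζ > 0. Let S = ((c_1, a_1), …, (c_L, a_L)) be a finite family with c_i ≥ 0 and a_i ∈ A, and set y_r = y − Σ_{i=1}^L c_i a_i. If ⟨y_r, a⟩ ≤ ζ⁻¹ for every a ∈ A, then for every x ∈ E with finite atomic norm, h(S) ≤ ‖x‖_A + (ζ/2)‖y − x‖² + | ζ⟨y_r, y − y_r⟩ − Σ_{i=1}^L c_i |. In other words, the mixed-integer objective of S exceeds the optimal AST objective by at most the duality-gap surrogate h'(S) = | ζ⟨y_r, y − y_r⟩ − Σ_i c_i |. -/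
open scoped RealInnerProductSpace BigOperators

variable {E : Type*} [NormedAddCommGroup E] [InnerProductSpace ℝ E]

/-- The set of values `∑ i, c i` over all finite conic decompositions
`x = ∑ i, c i • a i` with `c i > 0` and `a i ∈ A`. -/
def decompSums (A : Set E) (x : E) : Set ℝ :=
  { s | ∃ (L : ℕ) (c : Fin L → ℝ) (a : Fin L → E),
      (∀ i, 0 < c i) ∧ (∀ i, a i ∈ A) ∧ x = ∑ i, c i • a i ∧ s = ∑ i, c i }

/-- The atomic norm of `x` w.r.t. the atomic set `A` (as a real infimum; `x` has
finite atomic norm iff `decompSums A x` is nonempty). -/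
noncomputable def atomicNorm (A : Set E) (x : E) : ℝ := sInf (decompSums A x)

/-- The AST objective `g(x) = ‖x‖_A + (ζ/2)‖y − x‖²`. -/
noncomputable def astObj (A : Set E) (ζ : ℝ) (y x : E) : ℝ :=
  atomicNorm A x + ζ / 2 * ‖y - x‖ ^ 2

/-- The mixed-integer AST objective of a finite family `((c i, a i))_{i < L}`. -/
noncomputable def mixedObj (ζ : ℝ) (y : E) {L : ℕ} (c : Fin L → ℝ) (a : Fin L → E) : ℝ :=
  (∑ i, c i) + ζ / 2 * ‖y - ∑ i, c i • a i‖ ^ 2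

/-- A finite family is a global solution of the mixed-integer AST problem if its
objective is at most that of every admissible finite family. -/
def IsGlobalSolution (A : Set E) (ζ : ℝ) (y : E) {L : ℕ}
    (c : Fin L → ℝ) (a : Fin L → E) : Prop :=
  ∀ (L' : ℕ) (c' : Fin L' → ℝ) (a' : Fin L' → E),
    (∀ i, 0 ≤ c' i) → (∀ i, a' i ∈ A) → mixedObj ζ y c a ≤ mixedObj ζ y c' a'

/-- Weak duality: if `ζ • z` lies in the polar of `A`, then `ζ * ⟪z, x⟫` is a lower bound
for the atomic norm of any `x` that admits a decomposition. -/
theorem mul_inner_le_atomicNorm {A : Set E} {ζ : ℝ} (hζ : 0 < ζ) {z x : E}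
    (hz : ∀ b ∈ A, ⟪z, b⟫ ≤ ζ⁻¹) (hx : (decompSums A x).Nonempty) :
    ζ * ⟪z, x⟫ ≤ atomicNorm A x := by
  refine le_csInf hx ?_
  rintro s ⟨L, c, a, hc, ha, rfl, rfl⟩
  rw [inner_sum, Finset.mul_sum]
  refine Finset.sum_le_sum fun i _ => ?_
  calc ζ * ⟪z, c i • a i⟫ = c i * (ζ * ⟪z, a i⟫) := by rw [real_inner_smul_right]; ring
    _ ≤ c i * (ζ * ζ⁻¹) := by
      have := hz (a i) (ha i)
      have := (hc i).le
      gcongr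
    _ = c i := by rw [mul_inv_cancel₀ hζ.ne', mul_one]

theorem stmt10 (A : Set E) (hA : ∀ a ∈ A, -a ∈ A) (y : E) (ζ : ℝ) (hζ : 0 < ζ)
    {L : ℕ} (c : Fin L → ℝ) (a : Fin L → E) (hc : ∀ i, 0 ≤ c i) (ha : ∀ i, a i ∈ A)
    (hfeas : ∀ b ∈ A, ⟪y - ∑ i, c i • a i, b⟫ ≤ ζ⁻¹) :
    ∀ x : E, (decompSums A x).Nonempty →
      mixedObj ζ y c a ≤ astObj A ζ y x +
        |ζ * ⟪y - ∑ i, c i • a i, y - (y - ∑ i, c i • a i)⟫ - ∑ i, c i| := by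
  intro x hx
  have hdual := mul_inner_le_atomicNorm hζ hfeas hx
  unfold mixedObj astObj
  set u := ∑ i, c i • a i
  have hsub : y - (y - u) = u := sub_sub_cancel y u
  have hexp : ‖y - x‖ ^ 2 = ‖y - u‖ ^ 2 + 2 * (⟪y - u, u⟫ - ⟪y - u, x⟫) + ‖u - x‖ ^ 2 := by
    rw [← sub_add_sub_cancel y u x, norm_add_sq_real, inner_sub_right]
  have habs := neg_le_abs (ζ * ⟪y - u, u⟫ - ∑ i, c i)
  have hsq : 0 ≤ ζ / 2 * ‖u - x‖ ^ 2 := by positivity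
  rw [hsub, hexp]
  linarith
end

section
/- Let E be a real inner product space, A ⊆ E an atomic set symmetric with respect to the origin, y ∈ E, ζ > 0, and δ ∈ [0, 1). Let S = ((c_1, a_1), …, (c_L, a_L)) be a finite family with c_i ≥ 0 and a_i ∈ A, and set y_r = y − Σ_{i=1}^L c_i a_i. Suppose (a) ⟨y_r, a_i⟩ = (1 − δ) ζ⁻¹ for every index i with c_i > 0, and (b) ⟨y_r, a⟩ ≤ ζ⁻¹ for every a ∈ A. Then for every x ∈ E with finite atomic norm, h(S) ≤ ‖x‖_A + (ζ/2)‖y − x‖² + δ Σ_{i=1}^L c_i. -/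
open scoped RealInnerProductSpace BigOperators

variable {E : Type*} [NormedAddCommGroup E] [InnerProductSpace ℝ E]

/-- If `⟪r, b⟫ ≤ t` on the atoms, then `⟪r, x⟫ ≤ t * s` for every conic decomposition of `x` with
weight sum `s`. -/
theorem inner_le_mul_of_mem_decompSums {A : Set E} {r x : E} {s t : ℝ}
    (h : ∀ b ∈ A, ⟪r, b⟫ ≤ t) (hs : s ∈ decompSums A x) : ⟪r, x⟫ ≤ t * s := by
  obtain ⟨L, c, a, hc, ha, rfl, rfl⟩ := hs
  rw [inner_sum, Finset.mul_sum]
  refine Finset.sum_le_sum fun i _ => ?_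
  rw [real_inner_smul_right, mul_comm t]
  exact mul_le_mul_of_nonneg_left (h _ (ha i)) (hc i).le

theorem stmt11 (A : Set E) (hA : ∀ a ∈ A, -a ∈ A) (y : E) (ζ δ : ℝ) (hζ : 0 < ζ)
    (hδ0 : 0 ≤ δ) (hδ1 : δ < 1)
    {L : ℕ} (c : Fin L → ℝ) (a : Fin L → E) (hc : ∀ i, 0 ≤ c i) (ha : ∀ i, a i ∈ A)
    (hstat : ∀ i : Fin L, 0 < c i → ⟪y - ∑ j, c j • a j, a i⟫ = (1 - δ) * ζ⁻¹)
    (hfeas : ∀ b ∈ A, ⟪y - ∑ j, c j • a j, b⟫ ≤ ζ⁻¹) :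
    ∀ x : E, (decompSums A x).Nonempty →
      mixedObj ζ y c a ≤ astObj A ζ y x + δ * ∑ i, c i := by
  intro x hx
  unfold mixedObj astObj
  set z := ∑ j, c j • a j with hz
  have inner_family : ζ * ⟪y - z, z⟫ = (1 - δ) * ∑ i, c i := by
    have : ⟪y - z, z⟫ = ∑ i, c i * ((1 - δ) * ζ⁻¹) := by
      conv_lhs => rw [hz, inner_sum, ← hz]
      refine Finset.sum_congr rfl fun i _ => ?_
      rw [real_inner_smul_right]
      rcases (hc i).eq_or_lt with h | h
      · simp [← h]
      · rw [hstat i h]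
    rw [this, ← Finset.sum_mul]
    field_simp
  have inner_le : ζ * ⟪y - z, x⟫ ≤ atomicNorm A x := by
    refine le_csInf hx fun s hs => ?_
    calc ζ * ⟪y - z, x⟫ ≤ ζ * (ζ⁻¹ * s) :=
          mul_le_mul_of_nonneg_left (inner_le_mul_of_mem_decompSums hfeas hs) hζ.le
      _ = s := mul_inv_cancel_left₀ hζ.ne' s
  have expand : ‖y - x‖ ^ 2 = ‖y - z‖ ^ 2 + 2 * (⟪y - z, z⟫ - ⟪y - z, x⟫) + ‖z - x‖ ^ 2 := by
    rw [← inner_sub_right, ← norm_add_sq_real, sub_add_sub_cancel]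
  have : 0 ≤ ζ / 2 * ‖z - x‖ ^ 2 := by positivity
  rw [expand]
  linarith
end
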